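/- Position equivariance of the full vanilla RRM architecture without positional embeddings: fix a finite symbol alphabet C, an embedding e : C → (Fin D → ℝ) applied elementwise via (Ec X) d i = e (X i) d, an initial state Z⁰ : Matrix (Fin D) (Fin I) ℝ whose columns are all equal (Z⁰ d i = Z⁰ d i' for all i, i'), the recurrence Zstate 0 X = Z⁰ and Zstate (t+1) X = BlockL (Ec X + Zstate t X), and an output matrix W : Matrix (Fin K) (Fin D) ℝ with logits2 Z i k = ∑ d, W k d * Z d i. Then for every t : ℕ, every X : Fin I → C, and every σ : Equiv.Perm (Fin I), Zstate t (fun i => X (σ i)) = Pos σ (Zstate t X), and hence (logits2 (Zstate t (fun i => X (σ i)))) i k = (logits2 (Zstate t X)) (σ i) k. -/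

import Mathlib

open Matrix BigOperators

noncomputable def softmax {n : ℕ} (x : Fin n → ℝ) : Fin n → ℝ :=
  fun i => Real.exp (x i) / ∑ j, Real.exp (x j)

def Pos {D I : ℕ} (σ : Equiv.Perm (Fin I)) (H : Matrix (Fin D) (Fin I) ℝ) :
    Matrix (Fin D) (Fin I) ℝ :=
  fun d i => H d (σ i)

noncomputable def Attn {D I : ℕ} (Wq Wk Wv : Matrix (Fin D) (Fin D) ℝ)
    (H : Matrix (Fin D) (Fin I) ℝ) : Matrix (Fin D) (Fin I) ℝ :=
  fun d j =>
    ∑ i, (softmax (fun i' =>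
        dotProduct (Wq.mulVec (fun d => H d j)) (Wk.mulVec (fun d => H d i')))) i *
      (Wv.mulVec (fun d' => H d' i)) d

def Colwise {D I : ℕ} (g : (Fin D → ℝ) → (Fin D → ℝ))
    (H : Matrix (Fin D) (Fin I) ℝ) : Matrix (Fin D) (Fin I) ℝ :=
  fun d i => g (fun d' => H d' i) d

noncomputable def Layer {D I : ℕ} (Wq Wk Wv : Matrix (Fin D) (Fin D) ℝ)
    (norm m : (Fin D → ℝ) → (Fin D → ℝ))
    (H : Matrix (Fin D) (Fin I) ℝ) : Matrix (Fin D) (Fin I) ℝ :=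
  let H' := Colwise norm (H + Attn Wq Wk Wv H)
  Colwise norm (H' + Colwise m H')

noncomputable def Block {D I : ℕ} (Wq Wk Wv : Matrix (Fin D) (Fin D) ℝ)
    (norm m : (Fin D → ℝ) → (Fin D → ℝ)) (L : ℕ) :
    Matrix (Fin D) (Fin I) ℝ → Matrix (Fin D) (Fin I) ℝ :=
  (Layer Wq Wk Wv norm m)^[L]

def Ec {D I : ℕ} {C : Type*} (e : C → Fin D → ℝ) (X : Fin I → C) :
    Matrix (Fin D) (Fin I) ℝ :=
  fun d i => e (X i) d

/-- Iterated vanilla RRM recurrence: `Zstate 0 X = Z⁰`,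
`Zstate (t+1) X = BlockL (Ec X + Zstate t X)`. -/
noncomputable def Zstate {D I : ℕ} {C : Type*} (Wq Wk Wv : Matrix (Fin D) (Fin D) ℝ)
    (norm m : (Fin D → ℝ) → (Fin D → ℝ)) (L : ℕ) (e : C → Fin D → ℝ)
    (Z0 : Matrix (Fin D) (Fin I) ℝ) :
    ℕ → (Fin I → C) → Matrix (Fin D) (Fin I) ℝ
  | 0, _ => Z0
  | t + 1, X =>
      Block Wq Wk Wv norm m L (Ec e X + Zstate Wq Wk Wv norm m L e Z0 t X)

noncomputable def logits2 {D I K : ℕ} (W : Matrix (Fin K) (Fin D) ℝ)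
    (Z : Matrix (Fin D) (Fin I) ℝ) : Fin I → Fin K → ℝ :=
  fun i k => ∑ d, W k d * Z d i

theorem softmax_comp_perm {n : ℕ} (x : Fin n → ℝ) (σ : Equiv.Perm (Fin n)) (i : Fin n) :
    softmax (fun j => x (σ j)) i = softmax x (σ i) := by
  unfold softmax
  rw [Equiv.sum_comp σ (fun j => Real.exp (x j))]

theorem Pos_add {D I : ℕ} (σ : Equiv.Perm (Fin I)) (H H' : Matrix (Fin D) (Fin I) ℝ) :
    Pos σ (H + H') = Pos σ H + Pos σ H' :=
  rfl

theorem Colwise_Pos {D I : ℕ} (g : (Fin D → ℝ) → (Fin D → ℝ)) (σ : Equiv.Perm (Fin I))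
    (H : Matrix (Fin D) (Fin I) ℝ) : Colwise g (Pos σ H) = Pos σ (Colwise g H) :=
  rfl

theorem Ec_comp_perm {D I : ℕ} {C : Type*} (e : C → Fin D → ℝ) (X : Fin I → C)
    (σ : Equiv.Perm (Fin I)) : Ec e (fun i => X (σ i)) = Pos σ (Ec e X) :=
  rfl

theorem Attn_Pos {D I : ℕ} (Wq Wk Wv : Matrix (Fin D) (Fin D) ℝ) (σ : Equiv.Perm (Fin I))
    (H : Matrix (Fin D) (Fin I) ℝ) :
    Attn Wq Wk Wv (Pos σ H) = Pos σ (Attn Wq Wk Wv H) := by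
  funext d j
  simp only [Attn, Pos]
  conv_rhs => rw [← Equiv.sum_comp σ]
  refine Finset.sum_congr rfl fun i _ => ?_
  congr 1
  exact softmax_comp_perm
    (fun i' => dotProduct (Wq.mulVec (fun d => H d (σ j))) (Wk.mulVec (fun d => H d i'))) σ i

theorem Layer_Pos {D I : ℕ} (Wq Wk Wv : Matrix (Fin D) (Fin D) ℝ)
    (norm m : (Fin D → ℝ) → (Fin D → ℝ)) (σ : Equiv.Perm (Fin I))
    (H : Matrix (Fin D) (Fin I) ℝ) :
    Layer Wq Wk Wv norm m (Pos σ H) = Pos σ (Layer Wq Wk Wv norm m H) := by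
  simp only [Layer, Attn_Pos, ← Pos_add, Colwise_Pos]

theorem Block_Pos {D I : ℕ} (Wq Wk Wv : Matrix (Fin D) (Fin D) ℝ)
    (norm m : (Fin D → ℝ) → (Fin D → ℝ)) (L : ℕ) (σ : Equiv.Perm (Fin I))
    (H : Matrix (Fin D) (Fin I) ℝ) :
    Block Wq Wk Wv norm m L (Pos σ H) = Pos σ (Block Wq Wk Wv norm m L H) :=
  (Function.Commute.iterate_left (Layer_Pos Wq Wk Wv norm m σ) L) H

theorem Zstate_comp_perm {D I : ℕ} {C : Type*} (Wq Wk Wv : Matrix (Fin D) (Fin D) ℝ)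
    (norm m : (Fin D → ℝ) → (Fin D → ℝ)) (L : ℕ) (e : C → Fin D → ℝ)
    (Z0 : Matrix (Fin D) (Fin I) ℝ) (hZ0 : ∀ d i i', Z0 d i = Z0 d i')
    (t : ℕ) (X : Fin I → C) (σ : Equiv.Perm (Fin I)) :
    Zstate Wq Wk Wv norm m L e Z0 t (fun i => X (σ i))
      = Pos σ (Zstate Wq Wk Wv norm m L e Z0 t X) := by
  induction t with
  | zero => exact funext₂ fun d i => hZ0 d i (σ i)
  | succ t ih => simp only [Zstate, ih, Ec_comp_perm, ← Pos_add, Block_Pos]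

theorem vanilla_rrm_position_equivariant {D I K : ℕ} {C : Type*} [Fintype C]
    (Wq Wk Wv : Matrix (Fin D) (Fin D) ℝ)
    (norm m : (Fin D → ℝ) → (Fin D → ℝ)) (L : ℕ)
    (e : C → Fin D → ℝ) (Z0 : Matrix (Fin D) (Fin I) ℝ)
    (hZ0 : ∀ d i i', Z0 d i = Z0 d i')
    (W : Matrix (Fin K) (Fin D) ℝ) :
    ∀ (t : ℕ) (X : Fin I → C) (σ : Equiv.Perm (Fin I)),
      Zstate Wq Wk Wv norm m L e Z0 t (fun i => X (σ i))
        = Pos σ (Zstate Wq Wk Wv norm m L e Z0 t X) ∧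
      ∀ (i : Fin I) (k : Fin K),
        logits2 W (Zstate Wq Wk Wv norm m L e Z0 t (fun i' => X (σ i'))) i k
          = logits2 W (Zstate Wq Wk Wv norm m L e Z0 t X) (σ i) k := by
  intro t X σ
  have h := Zstate_comp_perm Wq Wk Wv norm m L e Z0 hZ0 t X σ
  refine ⟨h, fun i k => ?_⟩
  rw [h]
  rfl
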